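/- Let A ∈ M_m(ℂ) with eigenvalues λ_1, ..., λ_m counted with multiplicity, and let H be a limit point of the sequence {|A^n|^{1/n}}_{n ∈ ℕ}. Then for every p ∈ (0, ∞), tr(H^p) = ∑_{i=1}^m |λ_i|^p. -/

import Mathlib

open Filter Matrix Polynomial

/-- `absPow T p` is the matrix `|T|^p = (TᴴT)^{p/2}`, the `p`-th power (by functional
calculus) of the positive-semidefinite square root `|T| := √(TᴴT)`. -/
noncomputable def absPow {m : ℕ} (T : Matrix (Fin m) (Fin m) ℂ) (p : ℝ) :
    Matrix (Fin m) (Fin m) ℂ :=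
  cfc (fun x : ℝ => x ^ (p / 2)) (Tᴴ * T)

open scoped InnerProductSpace

section Growth

variable {V : Type*} [NormedAddCommGroup V] [NormedSpace ℂ V]

/-- The sum of the generalized eigenspaces of `f` for the eigenvalues in `S`. -/
def spectralSubspace (f : Module.End ℂ V) (S : Set ℂ) : Submodule ℂ V :=
  ⨆ μ ∈ S, f.maxGenEigenspace μ

theorem map_mem_spectralSubspace (f : Module.End ℂ V) (S : Set ℂ) :
    ∀ v ∈ spectralSubspace f S, f v ∈ spectralSubspace f S := by
  intro v hv
  have hle : spectralSubspace f S ≤ (spectralSubspace f S).comap f :=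
    iSup₂_le fun μ hμ w hw => (le_iSup₂_of_le (f := fun μ (_ : μ ∈ S) => f.maxGenEigenspace μ)
      μ hμ le_rfl) (Module.End.mapsTo_maxGenEigenspace_of_comm (Commute.refl f) μ hw)
  exact hle hv

theorem mem_of_hasEigenvalue_restrict (f : Module.End ℂ V) (S : Set ℂ) {μ : ℂ}
    (h : Module.End.HasEigenvalue (f.restrict (map_mem_spectralSubspace f S)) μ) :
    μ ∈ S ∧ f.HasEigenvalue μ := by
  obtain ⟨v, hv⟩ := h.exists_hasEigenvector
  have hfv : f v = μ • (v : V) := congrArg Subtype.val hv.apply_eq_smul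
  have hv0 : (v : V) ≠ 0 := fun h0 => hv.2 (Subtype.ext h0)
  have hev : f.HasEigenvector μ v := ⟨Module.End.mem_eigenspace_iff.2 hfv, hv0⟩
  refine ⟨?_, Module.End.hasEigenvalue_of_hasEigenvector hev⟩
  by_contra hμ
  have hd := f.independent_maxGenEigenspace.disjoint_biSup hμ
  exact hv0 (Submodule.disjoint_def.1 hd v
    ((f.genEigenspace μ).mono le_top hev.1) v.2)

variable [FiniteDimensional ℂ V]

theorem spectrum_toContinuousLinearMap (f : Module.End ℂ V) :
    spectrum ℂ (LinearMap.toContinuousLinearMap f) = spectrum ℂ f :=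
  AlgEquiv.spectrum_eq (Module.End.toContinuousLinearMap V) f

theorem eventually_norm_pow_le_of_spectrum {B : Type*} [NormedRing B] [NormedAlgebra ℂ B]
    [CompleteSpace B] (a : B) {r : ℝ} (hr : 0 < r) (h : ∀ μ ∈ spectrum ℂ a, ‖μ‖ < r) :
    ∀ᶠ n : ℕ in atTop, ‖a ^ n‖ ≤ r ^ n := by
  have hrad : spectralRadius ℂ a < ENNReal.ofReal r := by
    rcases (spectrum ℂ a).eq_empty_or_nonempty with he | hne
    · simpa [spectralRadius, he] using hr
    · refine spectrum.spectralRadius_lt_of_forall_lt_of_nonempty hne (r := r.toNNReal) fun μ hμ => ?_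
      rw [← NNReal.coe_lt_coe, Real.coe_toNNReal _ hr.le]
      exact h μ hμ
  have hlim := spectrum.pow_nnnorm_pow_one_div_tendsto_nhds_spectralRadius a
  filter_upwards [hlim.eventually_lt_const hrad, eventually_gt_atTop 0] with n hn hn0
  have hn' : (0 : ℝ) < n := Nat.cast_pos.2 hn0
  rw [one_div, ENNReal.rpow_inv_lt_iff hn', ENNReal.rpow_natCast, ← ENNReal.ofReal_pow hr.le] at hn
  rw [← ENNReal.ofReal_le_ofReal_iff (by positivity), ofReal_norm]
  exact hn.le

theorem eventually_norm_pow_apply_le (f : Module.End ℂ V) {r : ℝ} (hr : 0 < r)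
    (h : ∀ μ, f.HasEigenvalue μ → ‖μ‖ < r) :
    ∀ᶠ n : ℕ in atTop, ∀ v, ‖(f ^ n) v‖ ≤ r ^ n * ‖v‖ := by
  have := eventually_norm_pow_le_of_spectrum (LinearMap.toContinuousLinearMap f) hr fun μ hμ =>
    h μ (Module.End.hasEigenvalue_iff_mem_spectrum.2 (spectrum_toContinuousLinearMap f ▸ hμ))
  filter_upwards [this] with n hn v
  have hpow : LinearMap.toContinuousLinearMap f ^ n = LinearMap.toContinuousLinearMap (f ^ n) :=
    (map_pow (Module.End.toContinuousLinearMap V) f n).symm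
  rw [hpow] at hn
  exact (LinearMap.toContinuousLinearMap (f ^ n)).le_of_opNorm_le hn v

theorem eventually_le_norm_pow_apply (f : Module.End ℂ V) {r : ℝ} (hr : 0 < r)
    (h : ∀ μ, f.HasEigenvalue μ → r < ‖μ‖) :
    ∀ᶠ n : ℕ in atTop, ∀ v, r ^ n * ‖v‖ ≤ ‖(f ^ n) v‖ := by
  have hunit : IsUnit f := by
    rw [← spectrum.zero_notMem_iff ℂ]
    intro h0
    have := h 0 (Module.End.hasEigenvalue_iff_mem_spectrum.2 h0)
    rw [norm_zero] at this
    exact lt_asymm hr this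
  obtain ⟨u, rfl⟩ := hunit
  have := eventually_norm_pow_apply_le (↑u⁻¹ : Module.End ℂ V) (inv_pos.2 hr) fun μ hμ => by
    rw [Module.End.hasEigenvalue_iff_mem_spectrum, ← spectrum.map_inv, Set.mem_inv] at hμ
    have hlt := h _ (Module.End.hasEigenvalue_iff_mem_spectrum.2 hμ)
    rw [norm_inv] at hlt
    exact (lt_inv_comm₀ hr (inv_pos.1 (hr.trans hlt))).1 hlt
  filter_upwards [this] with n hn v
  have hv : ((↑u⁻¹ : Module.End ℂ V) ^ n) (((↑u : Module.End ℂ V) ^ n) v) = v := by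
    rw [← Module.End.mul_apply, ← Units.val_pow_eq_pow_val, ← Units.val_pow_eq_pow_val, inv_pow,
      Units.inv_mul, Module.End.one_apply]
  have := hn (((↑u : Module.End ℂ V) ^ n) v)
  rw [hv, inv_pow, ← div_eq_inv_mul, le_div_iff₀ (by positivity)] at this
  linarith

theorem finrank_finset_iSup_maxGenEigenspace (f : Module.End ℂ V) (s : Finset ℂ) :
    Module.finrank ℂ ↥(⨆ μ ∈ s, f.maxGenEigenspace μ) =
      ∑ μ ∈ s, f.charpoly.rootMultiplicity μ := by
  classical
  induction s using Finset.induction_on with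
  | empty => simp
  | insert a s ha ih =>
    rw [Finset.sum_insert ha, ← ih, Finset.iSup_insert, ← LinearMap.finrank_maxGenEigenspace_eq]
    have hd : Disjoint (f.maxGenEigenspace a) (⨆ μ ∈ s, f.maxGenEigenspace μ) :=
      f.independent_maxGenEigenspace.disjoint_biSup (y := (s : Set ℂ)) (by simpa using ha)
    rw [← Submodule.finrank_sup_add_finrank_inf_eq, hd.eq_bot, finrank_bot, add_zero]

theorem card_le_finrank_spectralSubspace {ι : Type*} [Fintype ι] (f : Module.End ℂ V) (μ : ι → ℂ)
    (hμ : f.charpoly = ∏ i, (X - C (μ i))) (S : Set ℂ) [DecidablePred (· ∈ S)] :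
    (Finset.univ.filter fun i => μ i ∈ S).card ≤ Module.finrank ℂ (spectralSubspace f S) := by
  classical
  set F := Finset.univ.filter fun i => μ i ∈ S
  have hle : (⨆ a ∈ F.image μ, f.maxGenEigenspace a) ≤ spectralSubspace f S := by
    refine iSup₂_le fun a ha => ?_
    obtain ⟨i, hi, rfl⟩ := Finset.mem_image.1 ha
    exact le_iSup₂_of_le (f := fun μ (_ : μ ∈ S) => f.maxGenEigenspace μ) (μ i)
      (Finset.mem_filter.1 hi).2 le_rfl
  refine le_trans ?_ (Submodule.finrank_mono hle)
  rw [finrank_finset_iSup_maxGenEigenspace, Finset.card_eq_sum_card_image μ F]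
  refine Finset.sum_le_sum fun a _ => ?_
  have hroots : f.charpoly.roots = Finset.univ.val.map μ := by
    rw [hμ, Finset.prod_eq_multiset_prod]
    change (Finset.univ.val.map ((fun a => X - C a) ∘ μ)).prod.roots = _
    rw [← Multiset.map_map, Polynomial.roots_multiset_prod_X_sub_C]
  rw [← Polynomial.count_roots, hroots, Multiset.count_map, ← Finset.filter_val, Finset.card_val]
  refine Finset.card_le_card fun i hi => ?_
  simpa using (Finset.mem_filter.1 hi).2.symm

theorem isRoot_of_hasEigenvalue {ι : Type*} [Fintype ι] (f : Module.End ℂ V) (μ : ι → ℂ)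
    (hμ : f.charpoly = ∏ i, (X - C (μ i))) {a : ℂ} (ha : f.HasEigenvalue a) : ∃ i, a = μ i := by
  have := (Module.End.hasEigenvalue_iff_isRoot_charpoly f a).1 ha
  rw [hμ, Polynomial.IsRoot, Polynomial.eval_prod, Finset.prod_eq_zero_iff] at this
  obtain ⟨i, -, hi⟩ := this
  exact ⟨i, by simpa [sub_eq_zero] using hi⟩

theorem eventually_norm_pow_apply_le_of_mem_spectralSubspace (f : Module.End ℂ V) {S : Set ℂ}
    {r : ℝ} (hr : 0 < r) (h : ∀ μ ∈ S, f.HasEigenvalue μ → ‖μ‖ < r) :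
    ∀ᶠ n : ℕ in atTop, ∀ v ∈ spectralSubspace f S, ‖(f ^ n) v‖ ≤ r ^ n * ‖v‖ := by
  filter_upwards [eventually_norm_pow_apply_le (f.restrict (map_mem_spectralSubspace f S)) hr
    fun μ hμ => h μ (mem_of_hasEigenvalue_restrict f S hμ).1
      (mem_of_hasEigenvalue_restrict f S hμ).2] with n hn v hv
  have := hn ⟨v, hv⟩
  rwa [Module.End.pow_restrict] at this

theorem eventually_le_norm_pow_apply_of_mem_spectralSubspace (f : Module.End ℂ V) {S : Set ℂ}
    {r : ℝ} (hr : 0 < r) (h : ∀ μ ∈ S, f.HasEigenvalue μ → r < ‖μ‖) :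
    ∀ᶠ n : ℕ in atTop, ∀ v ∈ spectralSubspace f S, r ^ n * ‖v‖ ≤ ‖(f ^ n) v‖ := by
  filter_upwards [eventually_le_norm_pow_apply (f.restrict (map_mem_spectralSubspace f S)) hr
    fun μ hμ => h μ (mem_of_hasEigenvalue_restrict f S hμ).1
      (mem_of_hasEigenvalue_restrict f S hμ).2] with n hn v hv
  have := hn ⟨v, hv⟩
  rwa [Module.End.pow_restrict] at this

end Growth

section Hermitian

variable {n : Type*} [Fintype n]

/-- The span of the vectors of an orthonormal basis with index in `S`. -/
def coordSubspace (b : OrthonormalBasis n ℂ (EuclideanSpace ℂ n)) (S : Finset n) :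
    Submodule ℂ (EuclideanSpace ℂ n) :=
  Submodule.span ℂ (Set.range fun i : S => b i)

theorem finrank_coordSubspace (b : OrthonormalBasis n ℂ (EuclideanSpace ℂ n)) (S : Finset n) :
    Module.finrank ℂ (coordSubspace b S) = S.card := by
  rw [coordSubspace, finrank_span_eq_card, Fintype.card_coe]
  exact b.orthonormal.linearIndependent.comp _ Subtype.val_injective

theorem inner_eq_zero_of_mem_coordSubspace {b : OrthonormalBasis n ℂ (EuclideanSpace ℂ n)}
    {S : Finset n} {v : EuclideanSpace ℂ n} (hv : v ∈ coordSubspace b S) {i : n} (hi : i ∉ S) :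
    ⟪b i, v⟫_ℂ = 0 := by
  have hle : coordSubspace b S ≤ (innerₛₗ ℂ (b i)).ker := by
    rw [coordSubspace, Submodule.span_le]
    rintro _ ⟨j, rfl⟩
    have hij : i ≠ j := fun h => hi (h ▸ j.2)
    simpa using b.orthonormal.2 hij
  simpa using hle hv

theorem weighted_sum_le_of_mem_coordSubspace {b : OrthonormalBasis n ℂ (EuclideanSpace ℂ n)}
    {S : Finset n} {v : EuclideanSpace ℂ n} (hv : v ∈ coordSubspace b S) {x : n → ℝ} {t : ℝ}
    (hx : ∀ i ∈ S, x i ≤ t) : ∑ i, ‖⟪b i, v⟫_ℂ‖ ^ 2 * x i ≤ t * ‖v‖ ^ 2 := by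
  rw [← b.sum_sq_norm_inner_right v, Finset.mul_sum]
  refine Finset.sum_le_sum fun i _ => ?_
  by_cases hi : i ∈ S
  · rw [mul_comm]
    exact mul_le_mul_of_nonneg_right (hx i hi) (by positivity)
  · simp [inner_eq_zero_of_mem_coordSubspace hv hi]

theorem le_weighted_sum_of_mem_coordSubspace {b : OrthonormalBasis n ℂ (EuclideanSpace ℂ n)}
    {S : Finset n} {v : EuclideanSpace ℂ n} (hv : v ∈ coordSubspace b S) {x : n → ℝ} {t : ℝ}
    (hx : ∀ i ∈ S, t ≤ x i) : t * ‖v‖ ^ 2 ≤ ∑ i, ‖⟪b i, v⟫_ℂ‖ ^ 2 * x i := by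
  have := weighted_sum_le_of_mem_coordSubspace hv (x := fun i => -x i) (t := -t)
    fun i hi => neg_le_neg (hx i hi)
  simp only [mul_neg, Finset.sum_neg_distrib] at this
  linarith

theorem exists_norm_eq_one_mem_of_finrank_lt {U W : Submodule ℂ (EuclideanSpace ℂ n)}
    (h : Fintype.card n < Module.finrank ℂ U + Module.finrank ℂ W) :
    ∃ v ∈ U, v ∈ W ∧ ‖v‖ = 1 := by
  obtain ⟨v, hU, hW, hv⟩ : ∃ v ∈ U, v ∈ W ∧ v ≠ 0 := by
    by_contra! hc
    have := Submodule.finrank_add_finrank_le_of_disjoint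
      (Submodule.disjoint_def.2 fun v hU hW => hc v hU hW)
    rw [finrank_euclideanSpace] at this
    omega
  exact ⟨((‖v‖⁻¹ : ℝ) : ℂ) • v, U.smul_mem _ hU, W.smul_mem _ hW,
    by simp [norm_smul, norm_ne_zero_iff.2 hv]⟩

variable [DecidableEq n]

theorem toEuclideanCLM_cfc_eigenvectorBasis {M : Matrix n n ℂ} (hM : M.IsHermitian) (f : ℝ → ℝ)
    (i : n) : toEuclideanCLM (𝕜 := ℂ) (cfc f M) (hM.eigenvectorBasis i) =
      (f (hM.eigenvalues i) : ℂ) • hM.eigenvectorBasis i := by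
  apply (WithLp.ofLp_injective 2)
  rw [ofLp_toEuclideanCLM, WithLp.ofLp_smul, hM.cfc_eq, IsHermitian.cfc,
    Unitary.conjStarAlgAut_apply, ← mulVec_mulVec, ← mulVec_mulVec,
    hM.star_eigenvectorUnitary_mulVec, diagonal_mulVec_single]
  rw [← hM.eigenvectorUnitary_mulVec, ← mulVec_smul]
  congr 1
  ext j
  by_cases h : j = i <;> simp [h]

theorem re_inner_cfc {M : Matrix n n ℂ} (hM : M.IsHermitian) (f : ℝ → ℝ)
    (v : EuclideanSpace ℂ n) :
    (⟪v, toEuclideanCLM (𝕜 := ℂ) (cfc f M) v⟫_ℂ).re =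
      ∑ i, ‖⟪hM.eigenvectorBasis i, v⟫_ℂ‖ ^ 2 * f (hM.eigenvalues i) := by
  have hv := hM.eigenvectorBasis.sum_repr' v
  have : toEuclideanCLM (𝕜 := ℂ) (cfc f M) v = ∑ i, ⟪hM.eigenvectorBasis i, v⟫_ℂ •
      (f (hM.eigenvalues i) : ℂ) • hM.eigenvectorBasis i := by
    conv_lhs => rw [← hv]
    simp only [map_sum, map_smul, toEuclideanCLM_cfc_eigenvectorBasis]
  rw [this, inner_sum, Complex.re_sum]
  refine Finset.sum_congr rfl fun i _ => ?_
  rw [inner_smul_right, inner_smul_right, ← inner_conj_symm v, mul_left_comm,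
    Complex.mul_conj, ← Complex.ofReal_mul, Complex.ofReal_re, Complex.normSq_eq_norm_sq, mul_comm]

theorem re_inner_eq_sum {M : Matrix n n ℂ} (hM : M.IsHermitian) (v : EuclideanSpace ℂ n) :
    (⟪v, toEuclideanCLM (𝕜 := ℂ) M v⟫_ℂ).re =
      ∑ i, ‖⟪hM.eigenvectorBasis i, v⟫_ℂ‖ ^ 2 * hM.eigenvalues i := by
  have := re_inner_cfc hM id v
  rwa [cfc_id ℝ M hM.isSelfAdjoint] at this

theorem trace_cfc {M : Matrix n n ℂ} (hM : M.IsHermitian) (f : ℝ → ℝ) :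
    (cfc f M).trace = ∑ i, (f (hM.eigenvalues i) : ℂ) := by
  rw [hM.cfc_eq, IsHermitian.cfc, Unitary.conjStarAlgAut_apply, trace_mul_cycle,
    Unitary.coe_star_mul_self, one_mul, trace_diagonal]
  rfl

theorem norm_toEuclideanCLM_sq (B : Matrix n n ℂ) (v : EuclideanSpace ℂ n) :
    ‖toEuclideanCLM (𝕜 := ℂ) B v‖ ^ 2 = (⟪v, toEuclideanCLM (𝕜 := ℂ) (Bᴴ * B) v⟫_ℂ).re := by
  rw [← star_eq_conjTranspose, map_mul, map_star, ContinuousLinearMap.star_eq_adjoint,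
    mul_apply_eq_comp, ContinuousLinearMap.adjoint_inner_right,
    inner_self_eq_norm_sq_to_K]
  norm_cast

end Hermitian

section Counting

theorem exists_gt_forall_lt {ι : Type*} [Finite ι] (x : ι → ℝ) (t : ℝ) :
    ∃ r > t, ∀ i, t < x i → r < x i := by
  have h : ∀ᶠ r in nhdsWithin t (Set.Ioi t), t < r ∧ ∀ i, t < x i → r < x i := by
    refine eventually_mem_nhdsWithin.and (eventually_all.2 fun i => ?_)
    by_cases hi : t < x i
    · filter_upwards [Ioo_mem_nhdsGT hi] with r hr _ using hr.2
    · exact Eventually.of_forall fun r h => absurd h hi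
  exact h.exists

theorem map_eq_of_card_lt_eq {ι : Type*} [Fintype ι] (x y : ι → ℝ)
    (h : ∀ t, (Finset.univ.filter fun i => t < x i).card =
      (Finset.univ.filter fun i => t < y i).card) :
    Finset.univ.val.map x = Finset.univ.val.map y := by
  classical
  have key : ∀ (z : ι → ℝ) (a b : ℝ), b < a → (∀ i, z i < a → z i < b) →
      (Finset.univ.val.map z).count a + (Finset.univ.filter fun i => a < z i).card =
        (Finset.univ.filter fun i => b < z i).card := by
    intro z a b hab hz
    rw [Multiset.count_map, ← Finset.filter_val, Finset.card_val, ← Finset.card_union_of_disjoint]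
    · congr 1
      ext i
      have := hz i
      simp only [Finset.mem_union, Finset.mem_filter, Finset.mem_univ, true_and]
      constructor
      · rintro (h | h) <;> linarith
      · intro h
        rcases lt_trichotomy (z i) a with h' | h' | h'
        · linarith [this h']
        · exact Or.inl h'.symm
        · exact Or.inr h'
    · rw [Finset.disjoint_filter]
      intro i _ h1 h2
      linarith
  ext a
  obtain ⟨r, hr, hlt⟩ := exists_gt_forall_lt (Sum.elim (fun i => -x i) fun i => -y i) (-a)
  have hx := key x a (-r) (by linarith) fun i hi => by
    have := hlt (Sum.inl i) (by simpa using hi)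
    simp only [Sum.elim_inl] at this
    linarith
  have hy := key y a (-r) (by linarith) fun i hi => by
    have := hlt (Sum.inr i) (by simpa using hi)
    simp only [Sum.elim_inr] at this
    linarith
  have h1 := h a
  have h2 := h (-r)
  omega

theorem card_filter_le_add_card_filter_lt {ι : Type*} [Fintype ι] (x : ι → ℝ) (t : ℝ) :
    (Finset.univ.filter fun i => x i ≤ t).card + (Finset.univ.filter fun i => t < x i).card =
      Fintype.card ι := by
  simpa using Finset.card_filter_add_card_filter_not (s := Finset.univ) fun i => x i ≤ t

end Counting

section LimitPoint

open scoped ComplexOrder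

variable {m : ℕ}

theorem charpoly_toEuclideanLin (A : Matrix (Fin m) (Fin m) ℂ) :
    LinearMap.charpoly (toEuclideanLin A) = A.charpoly := by
  rw [toEuclideanLin, toLpLin_eq_toLin, charpoly_toLin]

theorem toEuclideanLin_pow_apply (A : Matrix (Fin m) (Fin m) ℂ) (n : ℕ)
    (v : EuclideanSpace ℂ (Fin m)) :
    ((toEuclideanLin A : Module.End ℂ (EuclideanSpace ℂ (Fin m))) ^ n) v =
      toEuclideanCLM (𝕜 := ℂ) (A ^ n) v := by
  induction n with
  | zero => simp
  | succ n ih =>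
    rw [pow_succ', pow_succ', Module.End.mul_apply, ih, map_mul, mul_apply_eq_comp]
    rfl

theorem rpow_one_div_half_pow {x : ℝ} (hx : 0 ≤ x) {n : ℕ} (hn : n ≠ 0) :
    (x ^ (1 / (n : ℝ) / 2)) ^ (2 * n) = x := by
  have : (n : ℝ) ≠ 0 := Nat.cast_ne_zero.2 hn
  rw [← Real.rpow_natCast, ← Real.rpow_mul hx]
  convert Real.rpow_one x using 2
  push_cast
  field_simp

theorem isHermitian_absPow (T : Matrix (Fin m) (Fin m) ℂ) (p : ℝ) : (absPow T p).IsHermitian :=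
  cfc_predicate (p := IsSelfAdjoint) _ _

theorem re_inner_absPow_nonneg (T : Matrix (Fin m) (Fin m) ℂ) (p : ℝ)
    (v : EuclideanSpace ℂ (Fin m)) : 0 ≤ (⟪v, toEuclideanCLM (𝕜 := ℂ) (absPow T p) v⟫_ℂ).re := by
  rw [absPow, re_inner_cfc (posSemidef_conjTranspose_mul_self T).isHermitian]
  exact Finset.sum_nonneg fun i _ => mul_nonneg (by positivity)
    (Real.rpow_nonneg ((posSemidef_conjTranspose_mul_self T).eigenvalues_nonneg i) _)

theorem re_inner_absPow_pow_le (B : Matrix (Fin m) (Fin m) ℂ) {n : ℕ} (hn : n ≠ 0)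
    {v : EuclideanSpace ℂ (Fin m)} (hv : ‖v‖ = 1) :
    (⟪v, toEuclideanCLM (𝕜 := ℂ) (absPow B (1 / (n : ℝ))) v⟫_ℂ).re ^ (2 * n) ≤
      ‖toEuclideanCLM (𝕜 := ℂ) B v‖ ^ 2 := by
  have hM := posSemidef_conjTranspose_mul_self B
  rw [absPow, re_inner_cfc hM.isHermitian, norm_toEuclideanCLM_sq, re_inner_eq_sum hM.isHermitian]
  refine (Real.pow_arith_mean_le_arith_mean_pow _ _ _ (fun i _ => by positivity) ?_
    (fun i _ => Real.rpow_nonneg (hM.eigenvalues_nonneg i) _) _).trans_eq ?_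
  · rw [OrthonormalBasis.sum_sq_norm_inner_right, hv, one_pow]
  · exact Finset.sum_congr rfl fun i _ => by
      rw [rpow_one_div_half_pow (hM.eigenvalues_nonneg i) hn]

theorem abs_re_inner_sub_le {K L : EuclideanSpace ℂ (Fin m) →L[ℂ] EuclideanSpace ℂ (Fin m)}
    {v : EuclideanSpace ℂ (Fin m)} (hv : ‖v‖ = 1) :
    |(⟪v, K v⟫_ℂ).re - (⟪v, L v⟫_ℂ).re| ≤ ‖K - L‖ := by
  rw [← Complex.sub_re, ← inner_sub_right, ← _root_.sub_apply]
  refine (Complex.abs_re_le_norm _).trans ((norm_inner_le_norm _ _).trans ?_)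
  simpa [hv] using (K - L).le_opNorm v

variable {A H : Matrix (Fin m) (Fin m) ℂ} {φ : ℕ → ℕ}

theorem tendsto_norm_toEuclideanCLM_sub
    (hH : Tendsto (fun j => absPow (A ^ φ j) (1 / (φ j : ℝ))) atTop (nhds H)) :
    Tendsto (fun j => ‖toEuclideanCLM (𝕜 := ℂ) (absPow (A ^ φ j) (1 / (φ j : ℝ))) -
      toEuclideanCLM (𝕜 := ℂ) H‖) atTop (nhds 0) := by
  rw [← tendsto_iff_norm_sub_tendsto_zero]
  have hc : Continuous (toEuclideanCLM (𝕜 := ℂ) (n := Fin m)) :=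
    (toEuclideanCLM (𝕜 := ℂ) (n := Fin m)).toAlgEquiv.toLinearMap.continuous_of_finiteDimensional
  exact (hc.tendsto H).comp hH

theorem posSemidef_of_tendsto_absPow
    (hH : Tendsto (fun j => absPow (A ^ φ j) (1 / (φ j : ℝ))) atTop (nhds H)) :
    ∃ hherm : H.IsHermitian, ∀ i, 0 ≤ hherm.eigenvalues i := by
  have hherm : H.IsHermitian := by
    refine tendsto_nhds_unique ?_ hH
    refine ((continuous_id.matrix_conjTranspose.tendsto H).comp hH).congr fun j => ?_
    exact isHermitian_absPow _ _
  refine ⟨hherm, fun i => le_of_forall_pos_le_add fun ε hε => ?_⟩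
  obtain ⟨j, hj⟩ := ((tendsto_norm_toEuclideanCLM_sub hH).eventually_lt_const hε).exists
  have hb : ‖hherm.eigenvectorBasis i‖ = 1 := hherm.eigenvectorBasis.orthonormal.1 i
  have h1 := re_inner_absPow_nonneg (A ^ φ j) (1 / (φ j : ℝ)) (hherm.eigenvectorBasis i)
  have h2 := (abs_le.1 ((abs_re_inner_sub_le hb).trans hj.le)).2
  have h3 : (⟪hherm.eigenvectorBasis i,
      toEuclideanCLM (𝕜 := ℂ) H (hherm.eigenvectorBasis i)⟫_ℂ).re ≤ hherm.eigenvalues i := by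
    rw [re_inner_eq_sum hherm]
    have hmem : hherm.eigenvectorBasis i ∈ coordSubspace hherm.eigenvectorBasis {i} :=
      Submodule.subset_span ⟨⟨i, Finset.mem_singleton_self i⟩, rfl⟩
    simpa [hb] using weighted_sum_le_of_mem_coordSubspace hmem (x := hherm.eigenvalues)
      (t := hherm.eigenvalues i) (by simp)
  linarith

theorem card_eigenvalues_gt_le (μ : Fin m → ℂ) (hμ : A.charpoly = ∏ i, (X - C (μ i)))
    (hφ : StrictMono φ)
    (hH : Tendsto (fun j => absPow (A ^ φ j) (1 / (φ j : ℝ))) atTop (nhds H))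
    (hherm : H.IsHermitian) {t : ℝ} (ht : 0 ≤ t) :
    (Finset.univ.filter fun i => t < hherm.eigenvalues i).card ≤
      (Finset.univ.filter fun i => t < ‖μ i‖).card := by
  by_contra! hlt
  have hchar := (charpoly_toEuclideanLin A).trans hμ
  have hdim := card_le_finrank_spectralSubspace _ μ hchar {z : ℂ | ‖z‖ ≤ t}
  simp only [Set.mem_ofPred_eq] at hdim
  have hcard := card_filter_le_add_card_filter_lt (fun i => ‖μ i‖) t
  obtain ⟨v, hvH, hvA, hv⟩ := exists_norm_eq_one_mem_of_finrank_lt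
    (U := coordSubspace hherm.eigenvectorBasis
      (Finset.univ.filter fun i => t < hherm.eigenvalues i))
    (W := spectralSubspace (toEuclideanLin A) {z : ℂ | ‖z‖ ≤ t})
    (by rw [finrank_coordSubspace]; omega)
  obtain ⟨r, htr, hr⟩ := exists_gt_forall_lt hherm.eigenvalues t
  have hHv : r ≤ (⟪v, toEuclideanCLM (𝕜 := ℂ) H v⟫_ℂ).re := by
    rw [re_inner_eq_sum hherm]
    simpa [hv] using le_weighted_sum_of_mem_coordSubspace hvH (x := hherm.eigenvalues) (t := r)
      fun i hi => (hr i (Finset.mem_filter.1 hi).2).le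
  obtain ⟨s, hts, hsr⟩ := exists_between htr
  have hs : 0 < s := ht.trans_lt hts
  have hgrow := eventually_norm_pow_apply_le_of_mem_spectralSubspace (toEuclideanLin A)
    (S := {z : ℂ | ‖z‖ ≤ t}) hs fun z hz _ => lt_of_le_of_lt hz hts
  obtain ⟨j, hj, hgrow, hn⟩ := (((tendsto_norm_toEuclideanCLM_sub hH).eventually_lt_const
    (sub_pos.2 hsr)).and ((hφ.tendsto_atTop.eventually hgrow).and
      (hφ.tendsto_atTop.eventually (eventually_ne_atTop 0)))).exists
  have hK := (abs_le.1 (abs_re_inner_sub_le (K := toEuclideanCLM (𝕜 := ℂ)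
    (absPow (A ^ φ j) (1 / (φ j : ℝ)))) (L := toEuclideanCLM (𝕜 := ℂ) H) hv)).1
  have hJ := re_inner_absPow_pow_le (A ^ φ j) hn hv
  have hgv := hgrow v hvA
  rw [toEuclideanLin_pow_apply, hv, mul_one] at hgv
  have hsK : s < (⟪v, toEuclideanCLM (𝕜 := ℂ) (absPow (A ^ φ j) (1 / (φ j : ℝ))) v⟫_ℂ).re := by
    linarith
  have h1 := pow_lt_pow_left₀ hsK hs.le (mul_ne_zero two_ne_zero hn)
  have h2 := pow_le_pow_left₀ (norm_nonneg _) hgv 2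
  rw [← pow_mul, mul_comm (φ j)] at h2
  linarith

theorem card_le_card_eigenvalues_gt (μ : Fin m → ℂ) (hμ : A.charpoly = ∏ i, (X - C (μ i)))
    (hφ : StrictMono φ)
    (hH : Tendsto (fun j => absPow (A ^ φ j) (1 / (φ j : ℝ))) atTop (nhds H))
    (hherm : H.IsHermitian) {t : ℝ} (ht : 0 ≤ t) :
    (Finset.univ.filter fun i => t < ‖μ i‖).card ≤
      (Finset.univ.filter fun i => t < hherm.eigenvalues i).card := by
  by_contra! hlt
  have hchar := (charpoly_toEuclideanLin A).trans hμ
  have hdim := card_le_finrank_spectralSubspace _ μ hchar {z : ℂ | t < ‖z‖}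
  simp only [Set.mem_ofPred_eq] at hdim
  have hcard := card_filter_le_add_card_filter_lt hherm.eigenvalues t
  obtain ⟨r, htr, hr⟩ := exists_gt_forall_lt (fun i => ‖μ i‖) t
  obtain ⟨q, htq, hqr⟩ := exists_between htr
  have hq : 0 < q := ht.trans_lt htq
  have hgrow := eventually_le_norm_pow_apply_of_mem_spectralSubspace (toEuclideanLin A)
    (S := {z : ℂ | t < ‖z‖}) (hq.trans hqr) fun z hz hev => by
      obtain ⟨i, rfl⟩ := isRoot_of_hasEigenvalue _ μ hchar hev
      exact hr i hz
  obtain ⟨j, hj, hgrow, hn⟩ := (((tendsto_norm_toEuclideanCLM_sub hH).eventually_lt_const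
    (sub_pos.2 htq)).and ((hφ.tendsto_atTop.eventually hgrow).and
      (hφ.tendsto_atTop.eventually (eventually_ne_atTop 0)))).exists
  set n := φ j
  have hM := posSemidef_conjTranspose_mul_self (A ^ n)
  set z : Fin m → ℝ := fun i => hM.isHermitian.eigenvalues i ^ (1 / (n : ℝ) / 2)
  have hzcard := card_filter_le_add_card_filter_lt z q
  have hle : (Finset.univ.filter fun i => hherm.eigenvalues i ≤ t).card ≤
      (Finset.univ.filter fun i => z i ≤ q).card := by
    by_contra! hlt'
    obtain ⟨v, hvH, hvK, hv⟩ := exists_norm_eq_one_mem_of_finrank_lt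
      (U := coordSubspace hherm.eigenvectorBasis
        (Finset.univ.filter fun i => hherm.eigenvalues i ≤ t))
      (W := coordSubspace hM.isHermitian.eigenvectorBasis (Finset.univ.filter fun i => q < z i))
      (by rw [finrank_coordSubspace, finrank_coordSubspace]; omega)
    have hHv := weighted_sum_le_of_mem_coordSubspace hvH (x := hherm.eigenvalues)
      fun i hi => (Finset.mem_filter.1 hi).2
    have hKv := le_weighted_sum_of_mem_coordSubspace hvK (x := z)
      fun i hi => (Finset.mem_filter.1 hi).2.le
    rw [← re_inner_eq_sum hherm, hv] at hHv
    rw [← re_inner_cfc hM.isHermitian (fun x => x ^ (1 / (n : ℝ) / 2)), ← absPow, hv] at hKv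
    have hK := (abs_le.1 (abs_re_inner_sub_le (K := toEuclideanCLM (𝕜 := ℂ)
      (absPow (A ^ n) (1 / (n : ℝ)))) (L := toEuclideanCLM (𝕜 := ℂ) H) hv)).2
    linarith
  obtain ⟨v, hvK, hvA, hv⟩ := exists_norm_eq_one_mem_of_finrank_lt
    (U := coordSubspace hM.isHermitian.eigenvectorBasis (Finset.univ.filter fun i => z i ≤ q))
    (W := spectralSubspace (toEuclideanLin A) {z : ℂ | t < ‖z‖})
    (by rw [finrank_coordSubspace]; omega)
  have hup := weighted_sum_le_of_mem_coordSubspace hvK (x := hM.isHermitian.eigenvalues)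
    (t := q ^ (2 * n)) fun i hi => by
      rw [← rpow_one_div_half_pow (hM.eigenvalues_nonneg i) hn]
      exact pow_le_pow_left₀ (Real.rpow_nonneg (hM.eigenvalues_nonneg i) _)
        (Finset.mem_filter.1 hi).2 _
  rw [← re_inner_eq_sum hM.isHermitian, ← norm_toEuclideanCLM_sq, hv] at hup
  have hgv := hgrow v hvA
  rw [toEuclideanLin_pow_apply, hv, mul_one] at hgv
  have h1 := pow_lt_pow_left₀ hqr hq.le (mul_ne_zero two_ne_zero hn)
  have h2 := pow_le_pow_left₀ (pow_nonneg (hq.trans hqr).le n) hgv 2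
  rw [← pow_mul, mul_comm n] at h2
  linarith

end LimitPoint

/-- Let A ∈ M_m(ℂ) with eigenvalues λ_1, ..., λ_m counted with multiplicity, and let H be a
limit point of the sequence {|A^n|^{1/n}}. Then for every p ∈ (0, ∞),
tr(H^p) = ∑_{i=1}^m |λ_i|^p.  (Here H^p is the p-th power of the positive-semidefinite
matrix H by functional calculus.) -/
theorem trace_rpow_limit_point_eq_sum (m : ℕ) (A : Matrix (Fin m) (Fin m) ℂ)
    (μ : Fin m → ℂ) (hμ : A.charpoly = ∏ i, (X - C (μ i)))
    (H : Matrix (Fin m) (Fin m) ℂ) (φ : ℕ → ℕ) (hφ : StrictMono φ)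
    (hH : Tendsto (fun j => absPow (A ^ φ j) (1 / (φ j : ℝ))) atTop (nhds H))
    (p : ℝ) (hp : 0 < p) :
    (Matrix.trace (cfc (fun x : ℝ => x ^ p) H)).re = ∑ i, ‖μ i‖ ^ p := by
  obtain ⟨hherm, hnonneg⟩ := posSemidef_of_tendsto_absPow hH
  have hmap : Finset.univ.val.map hherm.eigenvalues = Finset.univ.val.map fun i => ‖μ i‖ := by
    refine map_eq_of_card_lt_eq _ _ fun t => ?_
    rcases le_or_gt 0 t with ht | ht
    · exact (card_eigenvalues_gt_le μ hμ hφ hH hherm ht).antisymm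
        (card_le_card_eigenvalues_gt μ hμ hφ hH hherm ht)
    · simp [fun i => ht.trans_le (hnonneg i), fun i => ht.trans_le (norm_nonneg (μ i))]
  have hsum := congrArg (fun s : Multiset ℝ => (s.map fun x => x ^ p).sum) hmap
  simp only [Multiset.map_map] at hsum
  rw [trace_cfc hherm, ← Complex.ofReal_sum, Complex.ofReal_re]
  exact hsum
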